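/- arXiv:2103.10352 — 3 statements merged into one kernel-verified Lean document; each statement's English description precedes it below -/
import Mathlib

section
/- Let λ > 0, p > 1, and 0 < K < λ be real numbers, let ξ(t) := (1 − (K/λ)·(1 − e^{−(p−1)λt}))^{−1/(p−1)}, and set ζ(t) := e^{−λt}·ξ(t) for t ≥ 0. Then ζ is differentiable on [0, ∞), and for every t ≥ 0 and every real W with 0 < W and W^{p−1} ≤ K, one has ζ'(t)·W + λ·ζ(t)·W − ζ(t)^p·W^p ≥ 0. -/
/-- The time factor `ζ(t) = e^{-λt} ξ(t)` from the proof of Theorem 4.2 is differentiable on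
`[0, ∞)` and satisfies `ζ'(t)·W + λ·ζ(t)·W - ζ(t)^p·W^p ≥ 0` for every `W > 0` with
`W^{p-1} ≤ K`. -/
theorem zeta_supersolution_factor (lam p K : ℝ) (hlam : 0 < lam) (hp : 1 < p)
    (hK0 : 0 < K) (hK : K < lam) (ξ ζ : ℝ → ℝ)
    (hξ : ∀ t : ℝ,
      ξ t = (1 - K / lam * (1 - Real.exp (-(p - 1) * lam * t))) ^ (-(1 / (p - 1))))
    (hζ : ∀ t : ℝ, ζ t = Real.exp (-lam * t) * ξ t) :
    (∀ t : ℝ, 0 ≤ t → DifferentiableAt ℝ ζ t) ∧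
    (∀ t : ℝ, 0 ≤ t → ∀ W : ℝ, 0 < W → W ^ (p - 1) ≤ K →
      0 ≤ deriv ζ t * W + lam * ζ t * W - ζ t ^ p * W ^ p) := by
  have hp1 : 0 < p - 1 := by linarith
  have hB : ∀ t : ℝ, 0 < 1 - K / lam * (1 - Real.exp (-(p - 1) * lam * t)) := by
    intro t
    have h1 : K / lam < 1 := (div_lt_one hlam).2 hK
    have h2 : 0 < K / lam * Real.exp (-(p - 1) * lam * t) := by positivity
    linarith
  have hξpos : ∀ t, 0 < ξ t := fun t => by
    rw [hξ t]; exact Real.rpow_pos_of_pos (hB t) _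
  have hζpos : ∀ t, 0 < ζ t := fun t => by
    rw [hζ t]; exact mul_pos (Real.exp_pos _) (hξpos t)
  have key : ∀ t, HasDerivAt ζ (K * ζ t ^ p - lam * ζ t) t := by
    intro t
    have hE : HasDerivAt (fun t : ℝ => Real.exp (-(p - 1) * lam * t))
        (Real.exp (-(p - 1) * lam * t) * (-(p - 1) * lam)) t := by
      simpa using ((hasDerivAt_id t).const_mul (-(p - 1) * lam)).exp
    have hL : HasDerivAt (fun t : ℝ => Real.exp (-lam * t))
        (Real.exp (-lam * t) * (-lam)) t := by
      simpa using ((hasDerivAt_id t).const_mul (-lam)).exp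
    have hb := ((hE.const_sub 1).const_mul (K / lam)).const_sub 1
    have hx := hb.rpow_const (p := -(1 / (p - 1))) (Or.inl (hB t).ne')
    have hz := hL.mul hx
    have hfun : ζ = (fun t : ℝ => Real.exp (-lam * t)) * (fun t : ℝ =>
        (1 - K / lam * (1 - Real.exp (-(p - 1) * lam * t))) ^ (-(1 / (p - 1)))) := by
      funext s
      simp only [Pi.mul_apply]
      rw [hζ s, hξ s]
    have hζp : ζ t ^ p = Real.exp (-lam * t) * Real.exp (-(p - 1) * lam * t) *
        (1 - K / lam * (1 - Real.exp (-(p - 1) * lam * t))) ^ (-(1 / (p - 1)) - 1) := by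
      rw [hζ t, Real.mul_rpow (Real.exp_pos _).le (hξpos t).le, hξ t,
        ← Real.rpow_mul (hB t).le, ← Real.exp_mul, ← Real.exp_add]
      congr 2
      · ring
      · field_simp
        ring
    rw [hζp, hζ t, hξ t, hfun]
    refine hz.congr_deriv ?_
    generalize (1 - K / lam * (1 - Real.exp (-(p - 1) * lam * t))) ^ (-(1 / (p - 1)) - 1) = X
    generalize (1 - K / lam * (1 - Real.exp (-(p - 1) * lam * t))) ^ (-(1 / (p - 1))) = Y
    generalize Real.exp (-(p - 1) * lam * t) = E
    generalize Real.exp (-lam * t) = F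
    have := hp1.ne'
    field_simp
    ring
  refine ⟨fun t _ => (key t).differentiableAt, fun t _ W hW hWK => ?_⟩
  rw [(key t).deriv]
  have hWp : W ^ p = W ^ (p - 1) * W := by
    rw [← Real.rpow_add_one hW.ne']; congr 1; ring
  rw [hWp]
  have h3 : 0 ≤ ζ t ^ p * W * (K - W ^ (p - 1)) :=
    mul_nonneg (mul_nonneg (Real.rpow_nonneg (hζpos t).le _) hW.le) (by linarith)
  linarith
end

section
/- Let n ≥ 2 be an integer and ν a real number with −n < ν ≤ 0, and let p > 1 + 2/(n + ν). Then there exist real numbers α > 0, C > 0, and t₀ ≥ 1 such that the function u(r,t) := C·(t + t₀)^{−α}·exp(−r²/(4(t + t₀))) satisfies 0 < u(r,t) ≤ 1 for all r > 0, t > 0, and the differential inequality ∂ₜu(r,t) − ∂ᵣᵣu(r,t) − ((n − 1 + ν)/r)·∂ᵣu(r,t) ≥ u(r,t)^p for all r > 0 and t > 0. -/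
/-- The radial content of Proposition 6.1: for `-n < ν ≤ 0` and `p > 1 + 2/(n+ν)` there are
`α > 0`, `C > 0`, `t₀ ≥ 1` such that `u(r,t) = C(t+t₀)^{-α} e^{-r²/(4(t+t₀))}` satisfies
`0 < u ≤ 1` and `∂ₜu - ∂ᵣᵣu - ((n-1+ν)/r)∂ᵣu ≥ u^p` for all `r > 0`, `t > 0`. -/
theorem radial_supersolution_A1 (n : ℕ) (hn : 2 ≤ n) (ν p : ℝ)
    (hν1 : -(n : ℝ) < ν) (hν2 : ν ≤ 0) (hp : 1 + 2 / ((n : ℝ) + ν) < p) :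
    ∃ α : ℝ, 0 < α ∧ ∃ C : ℝ, 0 < C ∧ ∃ t₀ : ℝ, 1 ≤ t₀ ∧
      ∀ (u : ℝ → ℝ → ℝ),
        (∀ r t : ℝ,
          u r t = C * (t + t₀) ^ (-α) * Real.exp (-(r ^ 2) / (4 * (t + t₀)))) →
        ∀ r : ℝ, 0 < r → ∀ t : ℝ, 0 < t →
          (0 < u r t ∧ u r t ≤ 1) ∧
          u r t ^ p ≤
            deriv (fun s => u r s) t - deriv (deriv (fun ρ => u ρ t)) r
              - (((n : ℝ) - 1 + ν) / r) * deriv (fun ρ => u ρ t) r := by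
  have hN : 0 < (n : ℝ) + ν := by linarith
  have hq : 0 < p - 1 := by
    have : 0 < 2 / ((n : ℝ) + ν) := by positivity
    linarith
  obtain ⟨α, hα⟩ : ∃ α : ℝ, α = 1 / (p - 1) := ⟨_, rfl⟩
  have hα0 : 0 < α := by rw [hα]; positivity
  have hαq : α * (p - 1) = 1 := by rw [hα]; field_simp
  obtain ⟨δ, hδ⟩ : ∃ δ : ℝ, δ = ((n : ℝ) + ν) / 2 - α := ⟨_, rfl⟩
  have hδ0 : 0 < δ := by
    have h1 : 2 / ((n : ℝ) + ν) < p - 1 := by linarith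
    rw [div_lt_iff₀ hN] at h1
    have : α < ((n : ℝ) + ν) / 2 := by
      rw [hα, div_lt_div_iff₀ hq (by norm_num)]
      linarith
    linarith
  obtain ⟨C, hC⟩ : ∃ C : ℝ, C = min 1 (δ ^ α) := ⟨_, rfl⟩
  have hC0 : 0 < C := by rw [hC]; positivity
  have hC1 : C ≤ 1 := by rw [hC]; exact min_le_left _ _
  have hCq : C ^ (p - 1) ≤ δ := by
    calc C ^ (p - 1) ≤ (δ ^ α) ^ (p - 1) :=
          Real.rpow_le_rpow hC0.le (by rw [hC]; exact min_le_right _ _) hq.le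
      _ = δ := by rw [← Real.rpow_mul hδ0.le, hαq, Real.rpow_one]
  refine ⟨α, hα0, C, hC0, 1, le_refl _, ?_⟩
  intro u hu r hr t ht
  have hT : 0 < t + 1 := by linarith
  have hTα : 0 < (t + 1) ^ (-α) := Real.rpow_pos_of_pos hT _
  have hu0 : 0 < u r t := by rw [hu]; positivity
  have hle : u r t ≤ C * (t + 1) ^ (-α) := by
    rw [hu]
    refine mul_le_of_le_one_right (by positivity) ?_
    rw [Real.exp_le_one_iff]
    apply div_nonpos_of_nonpos_of_nonneg
    · nlinarith [sq_nonneg r]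
    · linarith
  have hT1 : (t + 1) ^ (-α) ≤ 1 :=
    Real.rpow_le_one_of_one_le_of_nonpos (by linarith) (by linarith)
  have hu1 : u r t ≤ 1 := hle.trans (mul_le_one₀ hC1 hTα.le hT1)
  refine ⟨⟨hu0, hu1⟩, ?_⟩
  -- radial derivative
  have hr1 : ∀ ρ : ℝ, HasDerivAt (fun ρ => u ρ t) (-(ρ / (2 * (t + 1))) * u ρ t) ρ := by
    intro ρ
    have h : HasDerivAt (fun ρ : ℝ => -(ρ ^ 2) / (4 * (t + 1))) (-(ρ / (2 * (t + 1)))) ρ := by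
      refine HasDerivAt.congr_deriv (((hasDerivAt_pow 2 ρ).neg).div_const (4 * (t + 1))) ?_
      push_cast
      field_simp
      ring
    have h2 := (h.exp).const_mul (C * (t + 1) ^ (-α))
    have he : (fun ρ => u ρ t) =
        fun ρ => C * (t + 1) ^ (-α) * Real.exp (-(ρ ^ 2) / (4 * (t + 1))) := by
      funext x; exact hu x t
    rw [he, hu]
    exact h2.congr_deriv (by ring)
  have hd : deriv (fun ρ => u ρ t) = fun ρ => -(ρ / (2 * (t + 1))) * u ρ t := by
    funext ρ; exact (hr1 ρ).deriv
  have hr2 : deriv (deriv (fun ρ => u ρ t)) r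
      = -(1 / (2 * (t + 1))) * u r t
        + -(r / (2 * (t + 1))) * (-(r / (2 * (t + 1))) * u r t) := by
    rw [hd]
    exact ((((hasDerivAt_id r).div_const (2 * (t + 1))).neg).mul (hr1 r)).deriv
  have ht1 : deriv (fun s => u r s) t
      = (-α / (t + 1) + r ^ 2 / (4 * (t + 1) ^ 2)) * u r t := by
    have he : (fun s => u r s) =
        fun s => C * (s + 1) ^ (-α) * Real.exp (-(r ^ 2) / (4 * (s + 1))) := by
      funext x; exact hu r x
    have hs : HasDerivAt (fun s : ℝ => s + 1) 1 t := (hasDerivAt_id t).add_const 1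
    have ha := (hs.rpow_const (p := -α) (Or.inl hT.ne')).const_mul C
    have hb : HasDerivAt (fun s : ℝ => -(r ^ 2) / (4 * (s + 1)))
        (r ^ 2 / (4 * (t + 1) ^ 2)) t := by
      refine HasDerivAt.congr_deriv
        ((hasDerivAt_const t (-(r ^ 2))).div (hs.const_mul 4) (by positivity)) ?_
      field_simp
      ring
    rw [he, hu]
    refine (ha.mul hb.exp).deriv.trans ?_
    rw [Real.rpow_sub_one hT.ne']
    ring
  have hpow : u r t ^ (p - 1) ≤ δ / (t + 1) := by
    calc u r t ^ (p - 1) ≤ (C * (t + 1) ^ (-α)) ^ (p - 1) :=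
          Real.rpow_le_rpow hu0.le hle hq.le
      _ = C ^ (p - 1) * (t + 1)⁻¹ := by
          rw [Real.mul_rpow hC0.le hTα.le, ← Real.rpow_mul hT.le, neg_mul, hαq,
            Real.rpow_neg_one]
      _ ≤ δ / (t + 1) := by
          rw [div_eq_mul_inv]
          exact mul_le_mul_of_nonneg_right hCq (by positivity)
  have hup : u r t ^ p = u r t ^ (p - 1) * u r t := by
    rw [Real.rpow_sub_one hu0.ne']
    field_simp
  rw [hr2, ht1, hd, hup]
  refine (mul_le_mul_of_nonneg_right hpow hu0.le).trans (le_of_eq ?_)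
  rw [hδ]
  field_simp
  ring
end

section
/- Let n ≥ 2 be an integer, h₂ > 0, R₀ > 0, b₀ ∈ ℝ, Ĉ ≥ 0, and λ > Ĉ. Let a₂ > 0 satisfy 2a₂·(1 + R₀·(n−1)·h₂·coth(h₂R₀) + R₀·max(−b₀, 0)) ≤ λ − Ĉ, and define φ(r) := e^{−a₂ r²}. Then for every r with 0 < r ≤ R₀ and all real numbers F, B with F ≤ (n−1)·h₂·coth(h₂ r) and B ≥ b₀, one has φ''(r) + F·φ'(r) − B·φ'(r) + (λ − Ĉ)·φ(r) ≥ 0. -/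
theorem aux_sinh_convex : ConvexOn ℝ (Set.Ici (0:ℝ)) Real.sinh := by
  apply MonotoneOn.convexOn_of_deriv (convex_Ici 0) Real.continuous_sinh.continuousOn
    Real.differentiable_sinh.differentiableOn
  rw [Real.deriv_sinh, interior_Ici]
  intro a ha b hb hab
  simp only [Set.mem_Ioi] at ha hb
  rw [Real.cosh_le_cosh, abs_of_pos ha, abs_of_pos hb]
  exact hab

theorem aux_sinh_ratio {u v : ℝ} (hu : 0 ≤ u) (hv : 0 < v) (huv : u ≤ v) :
    v * Real.sinh u ≤ u * Real.sinh v := by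
  have h := aux_sinh_convex.2 (Set.mem_Ici.2 le_rfl) (Set.mem_Ici.2 hv.le)
    (show 0 ≤ 1 - u / v by rw [sub_nonneg, div_le_one hv]; exact huv)
    (show 0 ≤ u / v by positivity) (by ring)
  simp only [smul_eq_mul, mul_zero, zero_add, Real.sinh_zero] at h
  rw [div_mul_cancel₀ _ hv.ne', div_mul_eq_mul_div, le_div_iff₀ hv] at h
  linarith

theorem aux_coth {x y : ℝ} (hx : 0 < x) (hxy : x ≤ y) :
    x * (Real.cosh x / Real.sinh x) ≤ y * (Real.cosh y / Real.sinh y) := by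
  have hy : 0 < y := hx.trans_le hxy
  have h := aux_sinh_ratio (u := y - x) (v := y + x) (by linarith) (by linarith) (by linarith)
  rw [Real.sinh_sub, Real.sinh_add] at h
  rw [← mul_div_assoc, ← mul_div_assoc,
    div_le_div_iff₀ (Real.sinh_pos_iff.2 hx) (Real.sinh_pos_iff.2 hy)]
  linarith

/-- The interior computation (3.14) of Lemma 3.1: with `a₂ > 0` such that
`2a₂(1 + R₀(n-1)h₂ coth(h₂R₀) + R₀ max(-b₀, 0)) ≤ λ - Chat`, the function `φ(r) = e^{-a₂ r²}`
satisfies `φ'' + Fφ' - Bφ' + (λ - Chat)φ ≥ 0` for `0 < r ≤ R₀`, `F ≤ (n-1)h₂ coth(h₂ r)`,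
`B ≥ b₀`. -/
theorem interior_supersolution (n : ℕ) (hn : 2 ≤ n) (h₂ R₀ b₀ Chat lam a₂ : ℝ)
    (hh₂ : 0 < h₂) (hR₀ : 0 < R₀) (hChat : 0 ≤ Chat) (hlam : Chat < lam) (ha₂ : 0 < a₂)
    (ha : 2 * a₂ * (1 + R₀ * (n - 1 : ℝ) * h₂ * (Real.cosh (h₂ * R₀) / Real.sinh (h₂ * R₀))
        + R₀ * max (-b₀) 0) ≤ lam - Chat) :
    ∀ r : ℝ, 0 < r → r ≤ R₀ → ∀ F B : ℝ,
      F ≤ (n - 1 : ℝ) * h₂ * (Real.cosh (h₂ * r) / Real.sinh (h₂ * r)) → b₀ ≤ B →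
      0 ≤ deriv (deriv (fun s : ℝ => Real.exp (-a₂ * s ^ 2))) r
            + F * deriv (fun s : ℝ => Real.exp (-a₂ * s ^ 2)) r
            - B * deriv (fun s : ℝ => Real.exp (-a₂ * s ^ 2)) r
            + (lam - Chat) * Real.exp (-a₂ * r ^ 2) := by
  intro r hr hrR F B hF hB
  have d1 : ∀ s : ℝ, HasDerivAt (fun s : ℝ => Real.exp (-a₂ * s ^ 2))
      (Real.exp (-a₂ * s ^ 2) * (-a₂ * (2 * s))) s := by
    intro s
    have := (((hasDerivAt_pow 2 s).const_mul (-a₂))).exp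
    simpa using this
  have e1 : deriv (fun s : ℝ => Real.exp (-a₂ * s ^ 2)) =
      fun s => Real.exp (-a₂ * s ^ 2) * (-a₂ * (2 * s)) := funext fun s => (d1 s).deriv
  have d2 : HasDerivAt (fun s : ℝ => Real.exp (-a₂ * s ^ 2) * (-a₂ * (2 * s)))
      (Real.exp (-a₂ * r ^ 2) * (-a₂ * (2 * r)) * (-a₂ * (2 * r))
        + Real.exp (-a₂ * r ^ 2) * (-a₂ * (2 * 1))) r :=
    (d1 r).mul (((hasDerivAt_id r).const_mul 2).const_mul (-a₂))
  rw [e1, d2.deriv]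
  have hn1 : (0:ℝ) ≤ n - 1 := by
    have : (2:ℝ) ≤ n := by exact_mod_cast hn
    linarith
  have hc := aux_coth (mul_pos hh₂ hr) (mul_le_mul_of_nonneg_left hrR hh₂.le)
  have hc2 := mul_le_mul_of_nonneg_left hc hn1
  have hF2 := mul_le_mul_of_nonneg_left hF hr.le
  have hm : -B ≤ max (-b₀) 0 := (neg_le_neg hB).trans (le_max_left _ _)
  have hm2 := mul_le_mul_of_nonneg_left hm hr.le
  have hm3 := mul_le_mul_of_nonneg_right hrR (le_max_right (-b₀) 0)
  have key : r * F - r * B ≤ R₀ * (n - 1 : ℝ) * h₂ * (Real.cosh (h₂ * R₀) / Real.sinh (h₂ * R₀))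
        + R₀ * max (-b₀) 0 := by linarith
  have key2 := mul_le_mul_of_nonneg_left key (by positivity : 0 ≤ 2 * a₂)
  have hq : 0 ≤ (2 * a₂ * r) ^ 2 := sq_nonneg _
  have hfin : 0 ≤ (2 * a₂ * r) ^ 2 - 2 * a₂ - 2 * a₂ * (r * F - r * B) + (lam - Chat) := by
    linarith
  have := mul_nonneg (Real.exp_pos (-a₂ * r ^ 2)).le hfin
  linarith
end
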